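/- Large-d limit for vanishing transverse-traceless data (Proposition 3.23): Suppose η = μ = 0 and |t| ≠ 1. Set L = 1 if |t| < 1 and L = |t|^{−1/q} if |t| > 1. Then for any assignment d ↦ ψ_d of a solution of the model Lichnerowicz equation L_d for each d > 0, the value ψ_d(0) converges to L rapidly as d → ∞: for every real r, d^r · |ψ_d(0) − L| → 0 as d → ∞. -/

import Mathlib

open Real Filter

/-- The 2π-periodic function equal to −1 on (−π,0) and 1 on (0,π). -/
noncomputable def lam (x : ℝ) : ℝ := if 0 < Real.sin x then 1 else -1

/-- The critical exponent q = 2n/(n−2). -/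
noncomputable def qex (n : ℕ) : ℝ := 2 * n / ((n : ℝ) - 2)

/-- The coupling constant κ = (n−1)/n. -/
noncomputable def kap (n : ℕ) : ℝ := ((n : ℝ) - 1) / n

/-- A solution of the model Lichnerowicz equation `L_d` with parameters t, γ, η, μ:
a 2π-periodic, positive, C¹ function, twice differentiable off the multiples of π,
satisfying the equation there. -/
def IsModelSolution (n : ℕ) (t γ η μ d : ℝ) (ψ : ℝ → ℝ) : Prop :=
  (∀ x, ψ (x + 2 * Real.pi) = ψ x) ∧
  (∀ x, 0 < ψ x) ∧
  ContDiff ℝ 1 ψ ∧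
  ∀ x : ℝ, (∀ k : ℤ, x ≠ (k : ℝ) * Real.pi) →
    DifferentiableAt ℝ (deriv ψ) x ∧
    -2 * kap n * qex n * d ^ (-(qex n - 2)) * deriv (deriv ψ) x
      - 2 * η ^ 2 * d ^ (-(2 * qex n)) * ψ x ^ (-qex n - 1)
      - kap n * (μ * d ^ (-qex n) + γ + lam x) ^ 2 * ψ x ^ (-qex n - 1)
      + kap n * (t + lam x) ^ 2 * ψ x ^ (qex n - 1) = 0

theorem nonpos_of_deriv2_pos {φ : ℝ → ℝ} {α β : ℝ} (hc : ContinuousOn φ (Set.Icc α β))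
    (h : ∀ x ∈ Set.Ioo α β, 0 < φ x → 0 < deriv (deriv φ) x) (hα : φ α ≤ 0) (hβ : φ β ≤ 0) :
    ∀ x ∈ Set.Icc α β, φ x ≤ 0 := by
  intro x hx
  by_contra! hpos
  obtain ⟨y, hy, hmax⟩ := isCompact_Icc.exists_isMaxOn ⟨x, hx⟩ hc
  have hφy : 0 < φ y := hpos.trans_le (hmax hx)
  have hyα : α < y := lt_of_le_of_ne hy.1 (by rintro rfl; linarith)
  have hyβ : y < β := lt_of_le_of_ne hy.2 (by rintro rfl; linarith)
  have hnhds := Icc_mem_nhds hyα hyβ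
  have hlmax : IsLocalMax φ y := hmax.isLocalMax hnhds
  have hdd := h y ⟨hyα, hyβ⟩ hφy
  have hlmin : IsLocalMin φ y :=
    isLocalMin_of_deriv_deriv_pos hdd hlmax.deriv_eq_zero (hc.continuousAt hnhds)
  have hconst : φ =ᶠ[nhds y] fun _ => φ y := by
    filter_upwards [hlmax, hlmin] with z hz hz' using le_antisymm hz hz'
  rw [hconst.deriv.deriv_eq] at hdd
  simp at hdd

theorem le_exp_decay {g : ℝ → ℝ} {α β k N : ℝ} (hg : ContDiff ℝ 1 g) (hk : 0 < k) (hN : 0 < N)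
    (hdiff : ∀ x ∈ Set.Ioo α β, DifferentiableAt ℝ (deriv g) x)
    (h : ∀ x ∈ Set.Ioo α β, 0 < g x → k ^ 2 * g x ≤ deriv (deriv g) x) (hle : ∀ x, g x ≤ N) :
    ∀ x ∈ Set.Icc α β, g x ≤ N * (exp (-k * (x - α)) + exp (-k * (β - x))) := by
  set b : ℝ → ℝ := fun x => N * (exp (-k * (x - α)) + exp (-k * (β - x))) with hb
  have hb0 : ∀ x, 0 < b x := fun x => by positivity
  have hb1 : ∀ x, HasDerivAt b (N * k * (exp (-k * (β - x)) - exp (-k * (x - α)))) x := by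
    intro x
    have h1 : HasDerivAt (fun x => -k * (x - α)) (-k * 1) x :=
      ((hasDerivAt_id x).sub_const α).const_mul (-k)
    have h2 : HasDerivAt (fun x => -k * (β - x)) (-k * -1) x :=
      ((hasDerivAt_id x).const_sub β).const_mul (-k)
    exact ((h1.exp.add h2.exp).const_mul N).congr_deriv (by ring)
  have hb2 : ∀ x, HasDerivAt (fun x => N * k * (exp (-k * (β - x)) - exp (-k * (x - α))))
      (k ^ 2 * b x) x := by
    intro x
    have h1 : HasDerivAt (fun x => -k * (x - α)) (-k * 1) x :=
      ((hasDerivAt_id x).sub_const α).const_mul (-k)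
    have h2 : HasDerivAt (fun x => -k * (β - x)) (-k * -1) x :=
      ((hasDerivAt_id x).const_sub β).const_mul (-k)
    exact ((h2.exp.sub h1.exp).const_mul (N * k)).congr_deriv (by simp only [hb]; ring)
  have hgd : Differentiable ℝ g := hg.differentiable (by norm_num)
  have hder : deriv (fun x => g x - b x) =
      fun x => deriv g x - N * k * (exp (-k * (β - x)) - exp (-k * (x - α))) := by
    funext x
    exact ((hgd x).hasDerivAt.sub (hb1 x)).deriv
  intro x hx
  have key := nonpos_of_deriv2_pos (φ := fun x => g x - b x) (α := α) (β := β)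
    (hgd.continuous.sub (by fun_prop)).continuousOn ?_ ?_ ?_ x hx
  · linarith
  · intro y hy hpos
    have hsub : HasDerivAt (fun x => deriv g x - N * k * (exp (-k * (β - x)) - exp (-k * (x - α))))
        (deriv (deriv g) y - k ^ 2 * b y) y := (hdiff y hy).hasDerivAt.sub (hb2 y)
    rw [hder, hsub.deriv]
    have := h y hy (by linarith [hb0 y])
    have : k ^ 2 * b y < k ^ 2 * g y := by gcongr; linarith
    linarith
  · have : N * 1 ≤ b α := by
      simp only [hb]; gcongr; simp; positivity
    linarith [hle α]
  · have : N * 1 ≤ b β := by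
      simp only [hb]; gcongr; simp; positivity
    linarith [hle β]

theorem le_of_periodic_of_deriv2_pos {φ : ℝ → ℝ} {U : ℝ} (hφ : ContDiff ℝ 1 φ)
    (hper : Function.Periodic φ (2 * π))
    (h : ∀ x : ℝ, (∀ k : ℤ, x ≠ k * π) → U < φ x → 0 < deriv (deriv φ) x) :
    ∀ x, φ x ≤ U := by
  intro x
  by_contra! hx
  have hpi := Real.pi_pos
  obtain ⟨y, -, hmax⟩ := isCompact_Icc.exists_isMaxOn
    (Set.nonempty_Icc.2 (by linarith : (0 : ℝ) ≤ 0 + 2 * π)) hφ.continuous.continuousOn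
  have hmax' : ∀ z, φ z ≤ φ y := by
    intro z
    obtain ⟨w, hw, hzw⟩ := hper.exists_mem_Ico₀ (by positivity) z
    rw [hzw]
    exact hmax ⟨hw.1, by linarith [hw.2]⟩
  have hUy : U < φ y := hx.trans_le (hmax' x)
  have hdy : deriv φ y = 0 :=
    IsLocalMax.deriv_eq_zero (Filter.Eventually.of_forall hmax')
  set j : ℤ := ⌊y / π⌋ with hj
  have hj1 : j * π ≤ y := (le_div_iff₀ hpi).1 (Int.floor_le _)
  have hj2 : y < (j + 1) * π := (div_lt_iff₀ hpi).1 (Int.lt_floor_add_one _)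
  have hev : ∀ᶠ z in nhdsWithin y (Set.Ioi y), U < φ z ∧ z < (j + 1) * π :=
    nhdsWithin_le_nhds ((hφ.continuous.continuousAt.eventually_const_lt hUy).and
      (eventually_lt_nhds hj2))
  obtain ⟨e, he, hsub⟩ := (mem_nhdsGT_iff_exists_Ioo_subset).1 hev
  have he' : y < e := he
  have hdpos : ∀ z ∈ Set.Ioo y e, 0 < deriv (deriv φ) z := by
    intro z hz
    refine h z (fun k hk => ?_) (hsub hz).1
    have h1 : (j : ℝ) * π < k * π := by rw [← hk]; linarith [hz.1]
    have h2 : (k : ℝ) * π < (j + 1) * π := by rw [← hk]; exact (hsub hz).2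
    have h3 : j < k := by exact_mod_cast lt_of_mul_lt_mul_right h1 hpi.le
    have h4 : k < j + 1 := by exact_mod_cast lt_of_mul_lt_mul_right h2 hpi.le
    omega
  have hcd : Continuous (deriv φ) := hφ.continuous_deriv le_rfl
  have hmono : StrictMonoOn (deriv φ) (Set.Icc y e) :=
    strictMonoOn_of_deriv_pos (convex_Icc _ _) hcd.continuousOn (by simpa using hdpos)
  have hmono' : StrictMonoOn φ (Set.Icc y e) := by
    refine strictMonoOn_of_deriv_pos (convex_Icc _ _) hφ.continuous.continuousOn ?_
    intro z hz
    rw [interior_Icc] at hz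
    rw [← hdy]
    exact hmono ⟨le_rfl, he'.le⟩ ⟨hz.1.le, hz.2.le⟩ hz.1
  exact absurd (hmax' e) (not_le.2 (hmono' ⟨le_rfl, he'.le⟩ ⟨he'.le, le_rfl⟩ he'))

theorem rpow_sub_rpow_mul_ge {q m u v : ℝ} (hq : 2 < q) (hm : 0 < m) (hv : m ≤ v) (huv : v ≤ u) :
    m ^ (q - 2) * (u - v) ≤ u ^ (q - 1) - v ^ (q - 1) := by
  have hv0 : 0 < v := hm.trans_le hv
  have hu0 : 0 < u := hv0.trans_le huv
  have e : ∀ x : ℝ, 0 < x → x ^ (q - 1) = x ^ (q - 2) * x := fun x hx => by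
    rw [← Real.rpow_add_one hx.ne']; congr 1; ring
  rw [e u hu0, e v hv0]
  have h1 : m ^ (q - 2) ≤ v ^ (q - 2) := Real.rpow_le_rpow hm.le hv (by linarith)
  have h2 : v ^ (q - 2) ≤ u ^ (q - 2) := Real.rpow_le_rpow hv0.le huv (by linarith)
  nlinarith [mul_le_mul_of_nonneg_right h1 (sub_nonneg.2 huv), mul_le_mul_of_nonneg_right h2 hu0.le]

/-- The nonlinearity of the model equation on an interval where the coefficients are constant. -/
noncomputable def forcing (q a b u : ℝ) : ℝ := a ^ 2 * u ^ (q - 1) - b ^ 2 * u ^ (-q - 1)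

/-- The primitive of `forcing` that vanishes at its zero. -/
noncomputable def potential (q a b u : ℝ) : ℝ :=
  (a * u ^ (q / 2) - b * u ^ (-(q / 2))) ^ 2 / q

theorem forcing_sub_ge {q a b m u v : ℝ} (hq : 2 < q) (hm : 0 < m) (hv : m ≤ v) (huv : v ≤ u) :
    a ^ 2 * m ^ (q - 2) * (u - v) ≤ forcing q a b u - forcing q a b v := by
  have h1 := mul_le_mul_of_nonneg_left (rpow_sub_rpow_mul_ge hq hm hv huv) (sq_nonneg a)
  have h2 : u ^ (-q - 1) ≤ v ^ (-q - 1) :=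
    Real.rpow_le_rpow_of_nonpos (hm.trans_le hv) huv (by linarith)
  have h3 := mul_le_mul_of_nonneg_left h2 (sq_nonneg b)
  unfold forcing
  nlinarith

theorem forcing_eq_zero {q a b u : ℝ} (hu : 0 < u) (h : a * u ^ q = b) :
    forcing q a b u = 0 := by
  unfold forcing
  have e : u ^ (q - 1) = u ^ q * u ^ q * u ^ (-q - 1) := by
    rw [← Real.rpow_add hu, ← Real.rpow_add hu]; congr 1; ring
  rw [e, ← h]; ring

theorem potential_eq_zero {q a b u : ℝ} (hu : 0 < u) (h : a * u ^ q = b) :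
    potential q a b u = 0 := by
  unfold potential
  have e : u ^ (q / 2) = u ^ q * u ^ (-(q / 2)) := by
    rw [← Real.rpow_add hu]; congr 1; ring
  rw [e, ← h]; ring

theorem hasDerivAt_potential {q a b u : ℝ} (hq : 2 < q) (hu : 0 < u) :
    HasDerivAt (potential q a b) (forcing q a b u) u := by
  have h1 := (Real.hasDerivAt_rpow_const (p := q / 2) (Or.inl hu.ne')).const_mul a
  have h2 := (Real.hasDerivAt_rpow_const (p := -(q / 2)) (Or.inl hu.ne')).const_mul b
  have h3 := ((h1.sub h2).pow 2).div_const q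
  refine h3.congr_deriv ?_
  unfold forcing
  have e1 : u ^ (q - 1) = u ^ (q / 2) * u ^ (q / 2) * u⁻¹ := by
    rw [← Real.rpow_neg_one, ← Real.rpow_add hu, ← Real.rpow_add hu]; congr 1; ring
  have e2 : u ^ (-q - 1) = u ^ (-(q / 2)) * u ^ (-(q / 2)) * u⁻¹ := by
    rw [← Real.rpow_neg_one, ← Real.rpow_add hu, ← Real.rpow_add hu]; congr 1; ring
  have e3 : u ^ (q / 2 - 1) = u ^ (q / 2) * u⁻¹ := by
    rw [← Real.rpow_neg_one, ← Real.rpow_add hu]; congr 1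
  have e4 : u ^ (-(q / 2) - 1) = u ^ (-(q / 2)) * u⁻¹ := by
    rw [← Real.rpow_neg_one, ← Real.rpow_add hu]; congr 1
  rw [e1, e2, e3, e4]
  have : q ≠ 0 := by linarith
  simp only [Pi.sub_apply]
  field_simp
  push_cast
  ring

theorem potential_le {q a b m M u v : ℝ} (hq : 2 < q) (hm : 0 < m)
    (hu : u ∈ Set.Icc m M) (hv : v ∈ Set.Icc m M) (h : a * v ^ q = b) :
    potential q a b u ≤ (a ^ 2 * M ^ (q - 1) + b ^ 2 * m ^ (-q - 1)) * |u - v| := by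
  have key := (convex_Icc m M).norm_image_sub_le_of_norm_hasDerivWithin_le
    (f := potential q a b) (f' := forcing q a b)
    (C := a ^ 2 * M ^ (q - 1) + b ^ 2 * m ^ (-q - 1))
    (fun x hx => (hasDerivAt_potential hq (hm.trans_le hx.1)).hasDerivWithinAt) ?_ hv hu
  · rw [potential_eq_zero (hm.trans_le hv.1) h, sub_zero] at key
    exact (le_abs_self _).trans key
  · intro x hx
    have hx0 : 0 < x := hm.trans_le hx.1
    have h1 : x ^ (q - 1) ≤ M ^ (q - 1) := Real.rpow_le_rpow hx0.le hx.2 (by linarith)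
    have h2 : x ^ (-q - 1) ≤ m ^ (-q - 1) :=
      Real.rpow_le_rpow_of_nonpos hm hx.1 (by linarith)
    have h1' := mul_le_mul_of_nonneg_left h1 (sq_nonneg a)
    have h2' := mul_le_mul_of_nonneg_left h2 (sq_nonneg b)
    have h3 : 0 ≤ a ^ 2 * x ^ (q - 1) := by positivity
    have h4 : 0 ≤ b ^ 2 * x ^ (-q - 1) := by positivity
    rw [Real.norm_eq_abs, abs_le]
    unfold forcing
    constructor <;> linarith

theorem abs_energy_le {q a b m M v ε k α : ℝ} {ψ : ℝ → ℝ} (hq : 2 < q) (hm : 0 < m)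
    (hε : 0 < ε) (hk : 0 < k) (hkε : ε * k ^ 2 ≤ a ^ 2 * m ^ (q - 2)) (hv : v ∈ Set.Icc m M)
    (hav : a * v ^ q = b) (hψ : ContDiff ℝ 1 ψ) (hψm : ∀ x, ψ x ∈ Set.Icc m M)
    (hode : ∀ x ∈ Set.Ioo α (α + π), DifferentiableAt ℝ (deriv ψ) x ∧
      ε * deriv (deriv ψ) x = forcing q a b (ψ x)) :
    ∀ x ∈ Set.Icc α (α + π), |ε / 2 * deriv ψ x ^ 2 - potential q a b (ψ x)| ≤
      (4 * ε * M + (a ^ 2 * M ^ (q - 1) + b ^ 2 * m ^ (-q - 1))) *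
        (2 * M * exp (-k * (π / 4))) := by
  have hpi := Real.pi_pos
  have hM : 0 < M := hm.trans_le (hv.1.trans hv.2)
  have hv0 : 0 < v := hm.trans_le hv.1
  have hψ0 : ∀ x, 0 < ψ x := fun x => hm.trans_le (hψm x).1
  have hfv : forcing q a b v = 0 := forcing_eq_zero hv0 hav
  have hψd : Differentiable ℝ ψ := hψ.differentiable (by norm_num)
  have hcd : Continuous (deriv ψ) := hψ.continuous_deriv le_rfl
  have hneg : deriv (fun x => v - ψ x) = fun x => -deriv ψ x :=
    funext fun x => deriv_const_sub v
  have hup := le_exp_decay (g := fun x => ψ x - v) (α := α) (β := α + π) (N := M)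
    (hψ.sub contDiff_const) hk hM
    (fun x hx => by simpa using (hode x hx).1)
    (fun x hx hpos => by
      have h1 := forcing_sub_ge (a := a) (b := b) hq hm hv.1 (by linarith : v ≤ ψ x)
      rw [hfv, ← (hode x hx).2] at h1
      have h2 := mul_le_mul_of_nonneg_right hkε hpos.le
      simp only [deriv_sub_const_fun]
      exact le_of_mul_le_mul_left (by linarith) hε)
    (fun x => by linarith [(hψm x).2])
  have hlo := le_exp_decay (g := fun x => v - ψ x) (α := α) (β := α + π) (N := M)
    (contDiff_const.sub hψ) hk hM
    (fun x hx => by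
      rw [hneg]
      exact (hode x hx).1.fun_neg)
    (fun x hx hpos => by
      have h1 := forcing_sub_ge (a := a) (b := b) hq hm (hψm x).1 (by linarith : ψ x ≤ v)
      have h2 := mul_le_mul_of_nonneg_right hkε hpos.le
      rw [hfv] at h1
      rw [hneg, deriv.fun_neg]
      refine le_of_mul_le_mul_left ?_ hε
      linarith [(hode x hx).2])
    (fun x => by linarith [hψ0 x, hv.2])
  set B : ℝ := 2 * M * exp (-k * (π / 4)) with hB
  have hB0 : 0 < B := by positivity
  have hBM : B ≤ 2 * M := by
    have : exp (-k * (π / 4)) ≤ 1 := by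
      rw [Real.exp_le_one_iff]; nlinarith
    nlinarith
  have hmid : ∀ x ∈ Set.Icc (α + π / 4) (α + 3 * π / 4), |ψ x - v| ≤ B := by
    intro x hx
    have hx' : x ∈ Set.Icc α (α + π) := ⟨by linarith [hx.1], by linarith [hx.2]⟩
    have h1 : exp (-k * (x - α)) ≤ exp (-k * (π / 4)) := by
      apply Real.exp_le_exp.2; nlinarith [hx.1]
    have h2 : exp (-k * (α + π - x)) ≤ exp (-k * (π / 4)) := by
      apply Real.exp_le_exp.2; nlinarith [hx.2]
    have h3 : M * (exp (-k * (x - α)) + exp (-k * (α + π - x))) ≤ B := by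
      rw [hB]; nlinarith
    rw [abs_le]
    constructor <;> linarith [hup x hx', hlo x hx']
  obtain ⟨c, hc, hslope⟩ := exists_deriv_eq_slope ψ (a := α + π / 4) (b := α + 3 * π / 4)
    (by linarith) hψd.continuous.continuousOn hψd.differentiableOn
  have hc' : c ∈ Set.Icc (α + π / 4) (α + 3 * π / 4) := ⟨hc.1.le, hc.2.le⟩
  have hdc : |deriv ψ c| ≤ 2 * B := by
    have e1 := hmid (α + π / 4) ⟨le_rfl, by linarith⟩
    have e2 := hmid (α + 3 * π / 4) ⟨by linarith, le_rfl⟩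
    rw [abs_le] at e1 e2
    have h3 := Real.pi_gt_three
    have hlen : α + 3 * π / 4 - (α + π / 4) = π / 2 := by ring
    rw [hslope, hlen, abs_div, abs_of_pos (by positivity : 0 < π / 2), div_le_iff₀ (by positivity),
      abs_le]
    constructor <;> nlinarith
  set E : ℝ → ℝ := fun x => ε / 2 * deriv ψ x ^ 2 - potential q a b (ψ x) with hE
  have hpc : Continuous fun x => potential q a b (ψ x) := by
    refine continuous_iff_continuousAt.2 fun x => ?_
    exact ContinuousAt.comp (hasDerivAt_potential hq (hψ0 x)).continuousAt
      hψd.continuous.continuousAt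
  have hEc : Continuous E := by fun_prop
  have hEd : ∀ x ∈ interior (Set.Icc α (α + π)), HasDerivAt E 0 x := by
    intro x hx
    rw [interior_Icc] at hx
    obtain ⟨hd, heq⟩ := hode x hx
    have h1 := ((hd.hasDerivAt.pow 2).const_mul (ε / 2)).sub
      ((hasDerivAt_potential (a := a) (b := b) hq (hψ0 x)).comp x (hψd x).hasDerivAt)
    refine h1.congr_deriv ?_
    rw [← heq]; push_cast; ring
  have hmono : MonotoneOn E (Set.Icc α (α + π)) :=
    monotoneOn_of_deriv_nonneg (convex_Icc _ _) hEc.continuousOn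
      (fun x hx => (hEd x hx).differentiableAt.differentiableWithinAt)
      fun x hx => (hEd x hx).deriv.ge
  have hanti : AntitoneOn E (Set.Icc α (α + π)) :=
    antitoneOn_of_deriv_nonpos (convex_Icc _ _) hEc.continuousOn
      (fun x hx => (hEd x hx).differentiableAt.differentiableWithinAt)
      fun x hx => (hEd x hx).deriv.le
  intro x hx
  have hcI : c ∈ Set.Icc α (α + π) := ⟨by linarith [hc'.1], by linarith [hc'.2]⟩
  have hEq : E x = E c := by
    rcases le_total x c with h | h
    · exact le_antisymm (hmono hx hcI h) (hanti hx hcI h)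
    · exact le_antisymm (hanti hcI hx h) (hmono hcI hx h)
  change |E x| ≤ _
  rw [hEq]
  have hp0 : 0 ≤ potential q a b (ψ c) := by
    unfold potential; have : 0 < q := by linarith
    positivity
  have hp1 := potential_le (a := a) (b := b) hq hm (hψm c) hv hav
  have hK : 0 ≤ a ^ 2 * M ^ (q - 1) + b ^ 2 * m ^ (-q - 1) := by positivity
  have hp2 := hp1.trans (mul_le_mul_of_nonneg_left (hmid c hc') hK)
  have hd2 : deriv ψ c ^ 2 ≤ 8 * M * B := by
    rw [← sq_abs]
    nlinarith [abs_nonneg (deriv ψ c)]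
  have hd3 : ε / 2 * deriv ψ c ^ 2 ≤ ε / 2 * (8 * M * B) := by gcongr
  have hd4 : 0 ≤ ε / 2 * deriv ψ c ^ 2 := by positivity
  have hεM : 0 ≤ ε * M * B := by positivity
  have hKB := mul_nonneg hK hB0.le
  simp only [hE]
  rw [abs_le]
  constructor <;> nlinarith

theorem mul_abs_sub_le_abs_rpow_sub {q u L : ℝ} (hq : 1 ≤ q) (hu : 0 < u) (hL : 0 < L) :
    L ^ (q - 1) * |u - L| ≤ |u ^ q - L ^ q| := by
  have e : ∀ x : ℝ, 0 < x → x ^ q = x ^ (q - 1) * x := fun x hx => by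
    rw [← Real.rpow_add_one hx.ne']; congr 1; ring
  rw [e u hu, e L hL]
  rcases le_total L u with h | h
  · have h1 : L ^ (q - 1) ≤ u ^ (q - 1) := Real.rpow_le_rpow hL.le h (by linarith)
    rw [abs_of_nonneg (sub_nonneg.2 h)]
    refine le_trans ?_ (le_abs_self _)
    nlinarith
  · have h1 : u ^ (q - 1) ≤ L ^ (q - 1) := Real.rpow_le_rpow hu.le h (by linarith)
    rw [abs_of_nonpos (sub_nonpos.2 h)]
    refine le_trans ?_ (neg_le_abs _)
    nlinarith

theorem sq_mul_rpow_sub_one_le {q a₁ a₂ b₁ b₂ v₁ v₂ u s K D : ℝ} (hq : 2 < q)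
    (ha₁ : 0 < a₁) (ha₂ : 0 < a₂) (hu : 0 < u) (hv₁ : 0 < v₁) (hv₂ : 0 < v₂)
    (h₁ : a₁ * v₁ ^ q = b₁) (h₂ : a₂ * v₂ ^ q = b₂)
    (hmin : min v₁ v₂ ≤ u) (hmax : u ≤ max v₁ v₂) (ha : a₁ + a₂ = 2 * s) (hb : b₁ + b₂ = 2)
    (hK₁ : |K - potential q a₁ b₁ u| ≤ D) (hK₂ : |K - potential q a₂ b₂ u| ≤ D) :
    (s * u ^ q - 1) ^ 2 ≤ max v₁ v₂ ^ q * (q * D) := by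
  set Y := u ^ (q / 2) with hY
  set Z := u ^ (-(q / 2)) with hZ
  have hZ0 : 0 < Z := Real.rpow_pos_of_pos hu _
  have hY0 : 0 < Y := Real.rpow_pos_of_pos hu _
  have hYZ : Y * Z = 1 := by rw [hY, hZ, ← Real.rpow_add hu]; simp
  have hYY : u ^ q = Y ^ 2 := by rw [sq, hY, ← Real.rpow_add hu]; congr 1; ring
  have hq0 : 0 < q := by linarith
  have hsign : ∀ {a b v : ℝ}, a * v ^ q = b → a * Y - b * Z = a * Z * (u ^ q - v ^ q) := by
    intro a b v h
    rw [hYY, ← h]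
    linear_combination (-a * Y) * hYZ
  have hprod : (a₁ * Y - b₁ * Z) * (a₂ * Y - b₂ * Z) ≤ 0 := by
    rw [hsign h₁, hsign h₂]
    have : (u ^ q - v₁ ^ q) * (u ^ q - v₂ ^ q) ≤ 0 := by
      rcases le_total v₁ v₂ with h | h
      · rw [min_eq_left h] at hmin; rw [max_eq_right h] at hmax
        exact mul_nonpos_of_nonneg_of_nonpos
          (sub_nonneg.2 (Real.rpow_le_rpow hv₁.le hmin hq0.le))
          (sub_nonpos.2 (Real.rpow_le_rpow hu.le hmax hq0.le))
      · rw [min_eq_right h] at hmin; rw [max_eq_left h] at hmax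
        exact mul_nonpos_of_nonpos_of_nonneg
          (sub_nonpos.2 (Real.rpow_le_rpow hu.le hmax hq0.le))
          (sub_nonneg.2 (Real.rpow_le_rpow hv₂.le hmin hq0.le))
    have h0 : 0 < a₁ * Z * (a₂ * Z) := by positivity
    nlinarith
  have hdiff : |(a₁ * Y - b₁ * Z) ^ 2 - (a₂ * Y - b₂ * Z) ^ 2| ≤ 2 * (q * D) := by
    have e₁ : (a₁ * Y - b₁ * Z) ^ 2 = q * potential q a₁ b₁ u := by
      unfold potential; field_simp; rfl
    have e₂ : (a₂ * Y - b₂ * Z) ^ 2 = q * potential q a₂ b₂ u := by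
      unfold potential; field_simp; rfl
    rw [e₁, e₂, ← mul_sub, abs_mul, abs_of_pos hq0]
    rw [abs_le] at hK₁ hK₂
    have : |potential q a₁ b₁ u - potential q a₂ b₂ u| ≤ 2 * D := by
      rw [abs_le]; constructor <;> linarith
    nlinarith
  have hsum : ((a₁ * Y - b₁ * Z) + (a₂ * Y - b₂ * Z)) ^ 2 ≤ 2 * (q * D) := by
    refine le_trans ?_ hdiff
    rw [sq_sub_sq, abs_mul, ← sq_abs, sq]
    refine mul_le_mul_of_nonneg_left ?_ (abs_nonneg _)
    rw [← sq_le_sq]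
    nlinarith
  have hexp : (s * u ^ q - 1) ^ 2 =
      Y ^ 2 * ((a₁ * Y - b₁ * Z) + (a₂ * Y - b₂ * Z)) ^ 2 / 4 := by
    have : Y * ((a₁ * Y - b₁ * Z) + (a₂ * Y - b₂ * Z)) = 2 * (s * u ^ q - 1) := by
      rw [hYY]
      linear_combination Y ^ 2 * ha - hb - (b₁ + b₂) * hYZ
    rw [← mul_pow, this]; ring
  have hle : u ^ q ≤ max v₁ v₂ ^ q := Real.rpow_le_rpow hu.le hmax hq0.le
  rw [hexp, ← hYY]
  have hD : 0 ≤ D := (abs_nonneg _).trans hK₁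
  have hu' : 0 < u ^ q := Real.rpow_pos_of_pos hu _
  have hqD : 0 ≤ q * D := by positivity
  nlinarith [mul_le_mul_of_nonneg_left hsum hu'.le, mul_le_mul_of_nonneg_right hle hqD]

theorem mem_Icc_of_periodic_solution {q a₁ a₂ b₁ b₂ v₁ v₂ ε : ℝ} {ψ : ℝ → ℝ} (hq : 2 < q)
    (hε : 0 < ε) (ha₁ : 0 < a₁) (ha₂ : 0 < a₂) (hv₁ : 0 < v₁) (hv₂ : 0 < v₂)
    (h₁ : a₁ * v₁ ^ q = b₁) (h₂ : a₂ * v₂ ^ q = b₂) (hψ : ContDiff ℝ 1 ψ)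
    (hper : Function.Periodic ψ (2 * π)) (hpos : ∀ x, 0 < ψ x)
    (hode : ∀ x : ℝ, (∀ k : ℤ, x ≠ k * π) → ε * deriv (deriv ψ) x = forcing q a₁ b₁ (ψ x) ∨
      ε * deriv (deriv ψ) x = forcing q a₂ b₂ (ψ x)) :
    ∀ x, ψ x ∈ Set.Icc (min v₁ v₂) (max v₁ v₂) := by
  have hup : ∀ {a b v u : ℝ}, 0 < a → 0 < v → a * v ^ q = b → v < u → 0 < forcing q a b u := by
    intro a b v u ha hv h huv
    have h3 := forcing_sub_ge (a := a) (b := b) hq hv le_rfl huv.le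
    rw [forcing_eq_zero hv h] at h3
    have : 0 < a ^ 2 * v ^ (q - 2) * (u - v) :=
      mul_pos (by positivity) (sub_pos.2 huv)
    linarith
  have hlo : ∀ {a b v u : ℝ}, 0 < a → 0 < u → a * v ^ q = b → u < v → forcing q a b u < 0 := by
    intro a b v u ha hu h huv
    have h3 := forcing_sub_ge (a := a) (b := b) hq hu le_rfl huv.le
    rw [forcing_eq_zero (hu.trans huv) h] at h3
    have : 0 < a ^ 2 * u ^ (q - 2) * (v - u) :=
      mul_pos (by positivity) (sub_pos.2 huv)
    linarith
  have hle := le_of_periodic_of_deriv2_pos (U := max v₁ v₂) hψ hper (by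
    intro x hx hU
    refine (mul_pos_iff_of_pos_left hε).1 ?_
    rcases hode x hx with h | h <;> rw [h]
    · exact hup ha₁ hv₁ h₁ ((le_max_left _ _).trans_lt hU)
    · exact hup ha₂ hv₂ h₂ ((le_max_right _ _).trans_lt hU))
  have hneg : deriv (fun x => -ψ x) = fun x => -deriv ψ x := funext fun x => deriv.fun_neg
  have hge := le_of_periodic_of_deriv2_pos (φ := fun x => -ψ x) (U := -min v₁ v₂) hψ.neg
    (fun x => by simp only [hper x]) (by
    intro x hx hU
    have hU' : ψ x < min v₁ v₂ := by linarith
    rw [hneg, deriv.fun_neg]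
    refine (mul_pos_iff_of_pos_left hε).1 ?_
    rw [mul_neg, neg_pos]
    rcases hode x hx with h | h <;> rw [h]
    · exact hlo ha₁ (hpos x) h₁ (hU'.trans_le (min_le_left _ _))
    · exact hlo ha₂ (hpos x) h₂ (hU'.trans_le (min_le_right _ _)))
  exact fun x => ⟨by linarith [hge x], hle x⟩

theorem two_lt_qex {n : ℕ} (hn : 3 ≤ n) : 2 < qex n := by
  have : (3 : ℝ) ≤ n := by exact_mod_cast hn
  rw [qex, lt_div_iff₀ (by linarith)]
  linarith

theorem kap_pos {n : ℕ} (hn : 3 ≤ n) : 0 < kap n := by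
  have : (3 : ℝ) ≤ n := by exact_mod_cast hn
  exact div_pos (by linarith) (by linarith)

theorem IsModelSolution.deriv2_eq {n : ℕ} {t γ d : ℝ} {ψ : ℝ → ℝ} (hn : 3 ≤ n)
    (h : IsModelSolution n t γ 0 0 d ψ) {x : ℝ} (hx : ∀ k : ℤ, x ≠ k * π) :
    2 * qex n * d ^ (-(qex n - 2)) * deriv (deriv ψ) x =
      (t + lam x) ^ 2 * ψ x ^ (qex n - 1) - (γ + lam x) ^ 2 * ψ x ^ (-qex n - 1) := by
  have h2 := (h.2.2.2 x hx).2
  refine mul_left_cancel₀ (kap_pos hn).ne' ?_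
  linear_combination -h2

theorem IsModelSolution.of_sin_pos {n : ℕ} {t γ d : ℝ} {ψ : ℝ → ℝ} (hn : 3 ≤ n)
    (h : IsModelSolution n t γ 0 0 d ψ) {x : ℝ} (hx : 0 < sin x) :
    DifferentiableAt ℝ (deriv ψ) x ∧ 2 * qex n * d ^ (-(qex n - 2)) * deriv (deriv ψ) x =
      forcing (qex n) |t + 1| (1 + γ) (ψ x) := by
  have hx' : ∀ k : ℤ, x ≠ k * π := fun k hk => by simp [hk, Real.sin_int_mul_pi] at hx
  refine ⟨(h.2.2.2 x hx').1, ?_⟩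
  rw [h.deriv2_eq hn hx', lam, if_pos hx, forcing, sq_abs]
  ring

theorem IsModelSolution.of_sin_neg {n : ℕ} {t γ d : ℝ} {ψ : ℝ → ℝ} (hn : 3 ≤ n)
    (h : IsModelSolution n t γ 0 0 d ψ) {x : ℝ} (hx : sin x < 0) :
    DifferentiableAt ℝ (deriv ψ) x ∧ 2 * qex n * d ^ (-(qex n - 2)) * deriv (deriv ψ) x =
      forcing (qex n) |t - 1| (1 - γ) (ψ x) := by
  have hx' : ∀ k : ℤ, x ≠ k * π := fun k hk => by simp [hk, Real.sin_int_mul_pi] at hx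
  refine ⟨(h.2.2.2 x hx').1, ?_⟩
  rw [h.deriv2_eq hn hx', lam, if_neg hx.not_gt, forcing, sq_abs]
  ring

theorem exists_equilibrium {q a b : ℝ} (hq : q ≠ 0) (ha : 0 < a) (hb : 0 < b) :
    ∃ v : ℝ, 0 < v ∧ a * v ^ q = b := by
  refine ⟨(b / a) ^ q⁻¹, by positivity, ?_⟩
  rw [Real.rpow_inv_rpow (by positivity) hq]
  field_simp

/-- Exponential convergence of the value at the jump. -/
theorem IsModelSolution.exists_sq_sub_le_exp {n : ℕ} (hn : 3 ≤ n) {t γ s L : ℝ}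
    (hγ : -1 < γ ∧ γ < 1) (ht : |t| ≠ 1) (hs : 0 < s) (hL : 0 < L) (hsL : s * L ^ qex n = 1)
    (hst : |t + 1| + |t - 1| = 2 * s) :
    ∃ C c : ℝ, 0 < c ∧ ∀ d ψ, 1 ≤ d → IsModelSolution n t γ 0 0 d ψ →
      (ψ 0 - L) ^ 2 ≤ C * exp (-c * d ^ ((qex n - 2) / 2)) := by
  have hq := two_lt_qex hn
  set q := qex n with hqdef
  have hpi := Real.pi_pos
  have hq0 : 0 < q := by linarith
  have ha₁ : 0 < |t + 1| := abs_pos.2 fun h => ht (by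
    rw [eq_neg_of_add_eq_zero_left h]; simp)
  have ha₂ : 0 < |t - 1| := abs_pos.2 fun h => ht (by rw [sub_eq_zero.1 h]; simp)
  obtain ⟨v₁, hv₁, h₁⟩ := exists_equilibrium (b := 1 + γ) hq0.ne' ha₁ (by linarith)
  obtain ⟨v₂, hv₂, h₂⟩ := exists_equilibrium (b := 1 - γ) hq0.ne' ha₂ (by linarith)
  set m := min v₁ v₂ with hm
  set M := max v₁ v₂ with hM
  have hm0 : 0 < m := lt_min hv₁ hv₂
  have hM0 : 0 < M := hv₁.trans_le (le_max_left _ _)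
  set a := min |t + 1| |t - 1| with ha
  have ha0 : 0 < a := lt_min ha₁ ha₂
  set w : ℝ := √(a ^ 2 * m ^ (q - 2) / (2 * q)) with hw
  have hw0 : 0 < w := Real.sqrt_pos.2 (by positivity)
  have hw2 : 2 * q * w ^ 2 = a ^ 2 * m ^ (q - 2) := by
    rw [hw, Real.sq_sqrt (by positivity)]; field_simp
  have hwle : ∀ a', a ≤ a' → 2 * q * w ^ 2 ≤ a' ^ 2 * m ^ (q - 2) := fun a' h => by
    rw [hw2]; gcongr
  set F : ℝ → ℝ → ℝ := fun a b => a ^ 2 * M ^ (q - 1) + b ^ 2 * m ^ (-q - 1) with hF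
  have hF0 : ∀ a b, 0 ≤ F a b := fun a b => by positivity
  set K := 8 * q * M + F |t + 1| (1 + γ) + F |t - 1| (1 - γ) with hK
  refine ⟨M ^ q * (q * (K * (2 * M))) / (s * L ^ (q - 1)) ^ 2, w * (π / 4), by positivity, ?_⟩
  intro d ψ hd hsol
  have hd0 : 0 < d := by linarith
  set ε := 2 * q * d ^ (-(q - 2)) with hε
  have hε0 : 0 < ε := by positivity
  have hε1 : ε ≤ 2 * q := by
    have : d ^ (-(q - 2)) ≤ 1 := Real.rpow_le_one_of_one_le_of_nonpos hd (by linarith)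
    rw [hε]; nlinarith
  set k := w * d ^ ((q - 2) / 2) with hk
  have hk0 : 0 < k := by positivity
  have hεk : ε * k ^ 2 = 2 * q * w ^ 2 := by
    have : d ^ (-(q - 2)) * (d ^ ((q - 2) / 2) * d ^ ((q - 2) / 2)) = 1 := by
      rw [← Real.rpow_add hd0, ← Real.rpow_add hd0]
      ring_nf; simp
    rw [hε, hk]; linear_combination (2 * q * w ^ 2) * this
  have hbd : ∀ x, ψ x ∈ Set.Icc m M := by
    refine mem_Icc_of_periodic_solution hq hε0 ha₁ ha₂ hv₁ hv₂ h₁ h₂ hsol.2.2.1 hsol.1 hsol.2.1 ?_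
    intro x hx
    have hsin : sin x ≠ 0 := fun h => by
      obtain ⟨j, hj⟩ := Real.sin_eq_zero_iff.1 h
      exact hx j hj.symm
    rcases hsin.lt_or_gt with h | h
    · exact Or.inr (hsol.of_sin_neg hn h).2
    · exact Or.inl (hsol.of_sin_pos hn h).2
  set X := exp (-k * (π / 4)) with hX
  have hX0 : 0 < X := Real.exp_pos _
  have hE₁ := abs_energy_le (α := 0) hq hm0 hε0 hk0
    (hεk.trans_le (hwle _ (min_le_left _ _))) ⟨min_le_left _ _, le_max_left _ _⟩ h₁ hsol.2.2.1 hbd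
    (fun x hx => hsol.of_sin_pos hn (Real.sin_pos_of_pos_of_lt_pi hx.1 (by linarith [hx.2])))
    0 ⟨le_rfl, by linarith⟩
  have hE₂ := abs_energy_le (α := -π) hq hm0 hε0 hk0
    (hεk.trans_le (hwle _ (min_le_right _ _))) ⟨min_le_right _ _, le_max_right _ _⟩ h₂
    hsol.2.2.1 hbd
    (fun x hx => hsol.of_sin_neg hn
      (Real.sin_neg_of_neg_of_neg_pi_lt (by linarith [hx.2]) (by linarith [hx.1])))
    0 ⟨by linarith, by linarith⟩
  have hεM : 4 * ε * M ≤ 8 * q * M := by nlinarith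
  have hF₁ := hF0 |t + 1| (1 + γ)
  have hF₂ := hF0 |t - 1| (1 - γ)
  have hMX : 0 ≤ 2 * M * X := by positivity
  have hE₁' := hE₁.trans (mul_le_mul_of_nonneg_right
    (show 4 * ε * M + F |t + 1| (1 + γ) ≤ K by linarith) hMX)
  have hE₂' := hE₂.trans (mul_le_mul_of_nonneg_right
    (show 4 * ε * M + F |t - 1| (1 - γ) ≤ K by linarith) hMX)
  have hmain := sq_mul_rpow_sub_one_le hq ha₁ ha₂ (hsol.2.1 0) hv₁ hv₂ h₁ h₂ (hbd 0).1 (hbd 0).2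
    hst (by ring) hE₁' hE₂'
  have hlow := mul_abs_sub_le_abs_rpow_sub (by linarith : 1 ≤ q) (hsol.2.1 0) hL
  have hfac : s * ψ 0 ^ q - 1 = s * (ψ 0 ^ q - L ^ q) := by linear_combination hsL
  have hXeq : exp (-(w * (π / 4)) * d ^ ((q - 2) / 2)) = X := by
    rw [hX, hk]; congr 1; ring
  rw [hXeq, div_mul_eq_mul_div, le_div_iff₀ (by positivity)]
  calc (ψ 0 - L) ^ 2 * (s * L ^ (q - 1)) ^ 2 = s ^ 2 * (L ^ (q - 1) * |ψ 0 - L|) ^ 2 := by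
        rw [mul_pow (L ^ (q - 1)), sq_abs]; ring
    _ ≤ s ^ 2 * |ψ 0 ^ q - L ^ q| ^ 2 := by gcongr
    _ = (s * ψ 0 ^ q - 1) ^ 2 := by rw [sq_abs, hfac]; ring
    _ ≤ _ := hmain
    _ = _ := by ring

theorem tendsto_rpow_mul_exp_neg_rpow {c p : ℝ} (hc : 0 < c) (hp : 0 < p) (r : ℝ) :
    Tendsto (fun d : ℝ => d ^ r * exp (-c * d ^ p)) atTop (nhds 0) := by
  have h := (tendsto_rpow_mul_exp_neg_mul_atTop_nhds_zero (r / p) c hc).comp (tendsto_rpow_atTop hp)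
  refine h.congr' ?_
  filter_upwards [eventually_gt_atTop 0] with d hd
  simp only [Function.comp]
  rw [← Real.rpow_mul hd.le, mul_div_cancel₀ _ hp.ne']

/-- Large-d limit for vanishing transverse-traceless data (Proposition 3.23). -/
theorem large_d_limit (n : ℕ) (hn : 3 ≤ n) (t γ : ℝ)
    (hγ : -1 < γ ∧ γ < 1) (ht : |t| ≠ 1)
    (Ψ : ℝ → ℝ → ℝ) (hΨ : ∀ d : ℝ, 0 < d → IsModelSolution n t γ 0 0 d (Ψ d)) :
    ∀ r : ℝ,
      Tendsto (fun d : ℝ =>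
          d ^ r * |Ψ d 0 - (if |t| < 1 then 1 else |t| ^ (-(1 / qex n)))|)
        atTop (nhds 0) := by
  intro r
  have hq := two_lt_qex hn
  have hq0 : qex n ≠ 0 := by linarith
  set L : ℝ := if |t| < 1 then 1 else |t| ^ (-(1 / qex n)) with hLdef
  obtain ⟨s, hs, hL, hsL, hst⟩ : ∃ s : ℝ, 0 < s ∧ 0 < L ∧ s * L ^ qex n = 1 ∧
      |t + 1| + |t - 1| = 2 * s := by
    by_cases h : |t| < 1
    · refine ⟨1, one_pos, ?_⟩
      obtain ⟨h1, h2⟩ := abs_lt.1 h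
      rw [hLdef, if_pos h, abs_of_pos (by linarith : 0 < t + 1),
        abs_of_neg (by linarith : t - 1 < 0), Real.one_rpow]
      norm_num
      ring
    · have h1 : 1 < |t| := lt_of_le_of_ne (not_lt.1 h) ht.symm
      have h0 : 0 < |t| := by linarith
      refine ⟨|t|, h0, ?_⟩
      rw [hLdef, if_neg h]
      refine ⟨by positivity, ?_, ?_⟩
      · rw [← Real.rpow_mul h0.le, neg_mul, one_div, inv_mul_cancel₀ hq0, Real.rpow_neg_one,
          mul_inv_cancel₀ h0.ne']
      · rcases lt_abs.1 h1 with h2 | h2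
        · rw [abs_of_pos (by linarith : 0 < t + 1), abs_of_pos (by linarith : 0 < t - 1),
            abs_of_pos (by linarith : 0 < t)]
          ring
        · rw [abs_of_neg (by linarith : t + 1 < 0), abs_of_neg (by linarith : t - 1 < 0),
            abs_of_neg (by linarith : t < 0)]
          ring
  obtain ⟨C, c, hc, hbound⟩ :=
    IsModelSolution.exists_sq_sub_le_exp hn hγ ht hs hL hsL hst
  have hlim : Tendsto (fun d : ℝ => C * (d ^ (2 * r) * exp (-c * d ^ ((qex n - 2) / 2))))
      atTop (nhds 0) := by
    simpa using (tendsto_rpow_mul_exp_neg_rpow hc (by linarith) (2 * r)).const_mul C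
  have hsqrt := hlim.sqrt
  rw [Real.sqrt_zero] at hsqrt
  refine squeeze_zero' ?_ ?_ hsqrt
  · filter_upwards [eventually_gt_atTop 0] with d hd
    positivity
  · filter_upwards [eventually_ge_atTop 1] with d hd
    have hd0 : 0 < d := by linarith
    refine Real.le_sqrt_of_sq_le ?_
    have e : d ^ (2 * r) = (d ^ r) ^ 2 := by
      rw [sq, ← Real.rpow_add hd0, two_mul]
    rw [mul_pow, sq_abs, e]
    have := mul_le_mul_of_nonneg_left (hbound d (Ψ d) hd (hΨ d hd0)) (sq_nonneg (d ^ r))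
    linarith
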